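/- For every bin packing with conflicts instance (I, s, E) with conflict graph G = (I, E), there exists a packing of I into at most χ(G) + |L| + (3/2)·s(M) + (4/3)·s(S) bins, where χ(G) is the chromatic number of G, L = {ℓ ∈ I : s(ℓ) > 1/2}, M = {ℓ ∈ I : 1/3 < s(ℓ) ≤ 1/2}, and S = {ℓ ∈ I : s(ℓ) ≤ 1/3}. -/

import Mathlib

open Finset
open scoped Classical

/-- The weight charged to an item of size `r` when bounding the number of bins. -/
noncomputable def itemWeight (r : ℝ) : ℝ :=
  if 1/2 < r then 1 else if 1/3 < r then 3/2 * r else 4/3 * r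

theorem itemWeight_nonneg {r : ℝ} (hr : 0 ≤ r) : 0 ≤ itemWeight r := by
  unfold itemWeight
  split_ifs <;> linarith

theorem itemWeight_of_large {r : ℝ} (hr : 1/2 < r) : itemWeight r = 1 := by
  simp only [itemWeight, if_pos hr]

theorem four_thirds_mul_le_itemWeight {r : ℝ} (hr : r ≤ 1/2) :
    4/3 * r ≤ itemWeight r := by
  unfold itemWeight
  split_ifs <;> linarith

theorem half_lt_itemWeight {r : ℝ} (hr : 1/3 < r) : 1/2 < itemWeight r := by
  unfold itemWeight
  split_ifs <;> linarith

/-- The total weight of a set of items, split by item size. -/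
theorem sum_itemWeight {ι : Type*} (s : ι → ℝ) (C : Finset ι) :
    ∑ x ∈ C, itemWeight (s x) = ((C.filter fun x => 1/2 < s x).card : ℝ)
      + 3/2 * ∑ x ∈ C.filter (fun x => 1/3 < s x ∧ s x ≤ 1/2), s x
      + 4/3 * ∑ x ∈ C.filter (fun x => s x ≤ 1/3), s x := by
  rw [Finset.card_filter, Finset.sum_filter, Finset.sum_filter, Finset.mul_sum, Finset.mul_sum]
  push_cast
  rw [← Finset.sum_add_distrib, ← Finset.sum_add_distrib]
  refine Finset.sum_congr rfl fun x _ => ?_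
  unfold itemWeight
  split_ifs <;> grind

/-- A bin that has no room for an item smaller than all its contents has weight at least `1`,
unless it contains exactly one item of size greater than `1/3`, and that item is medium. -/
theorem one_le_weight_or_lonely {ι : Type*} (s : ι → ℝ) (D : Finset ι) (a : ℝ) (ha : 0 ≤ a)
    (hD : D.Nonempty) (hmin : ∀ x ∈ D, a ≤ s x) (hfull : 1 < ∑ x ∈ D, s x + a) :
    1 ≤ ∑ x ∈ D, itemWeight (s x) ∨
      (2/3 ≤ ∑ x ∈ D, itemWeight (s x) ∧ 1/3 ≤ itemWeight a ∧
        ∃ x ∈ D, 1/3 < s x ∧ s x ≤ 1/2 ∧ ∀ z ∈ D, 1/3 < s z → z = x) := by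
  have hw : ∀ x ∈ D, 0 ≤ itemWeight (s x) := fun x hx => itemWeight_nonneg (ha.trans (hmin x hx))
  by_cases hL : ∃ x ∈ D, 1/2 < s x
  · obtain ⟨x, hx, hxL⟩ := hL
    left
    rw [← itemWeight_of_large hxL]
    exact Finset.single_le_sum hw hx
  push Not at hL
  obtain ⟨y, hy⟩ := hD
  have ha2 : a ≤ 1/2 := (hmin y hy).trans (hL y hy)
  have hsum : 4/3 * ∑ x ∈ D, s x ≤ ∑ x ∈ D, itemWeight (s x) := by
    rw [Finset.mul_sum]
    exact Finset.sum_le_sum fun x hx => four_thirds_mul_le_itemWeight (hL x hx)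
  by_cases ha4 : a ≤ 1/4
  · left; linarith
  push Not at ha4
  by_cases hM : ∃ x ∈ D, 1/3 < s x
  · obtain ⟨x, hx, hxM⟩ := hM
    by_cases hz : ∀ z ∈ D, 1/3 < s z → z = x
    · right
      have := four_thirds_mul_le_itemWeight ha2
      exact ⟨by linarith, by linarith, x, hx, hxM, hL x hx, hz⟩
    push Not at hz
    obtain ⟨z, hzD, hzM, hne⟩ := hz
    left
    have h := Finset.sum_le_sum_of_subset_of_nonneg (f := fun x => itemWeight (s x))
      (Finset.insert_subset hzD (Finset.singleton_subset_iff.2 hx)) (fun i hi _ => hw i hi)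
    rw [Finset.sum_pair hne] at h
    linarith [half_lt_itemWeight hxM, half_lt_itemWeight hzM]
  push Not at hM
  left
  have ha3 : a ≤ 1/3 := (hmin y hy).trans (hM y hy)
  have hup := Finset.sum_le_card_nsmul D s (1/3) hM
  have hlow := Finset.card_nsmul_le_sum D s a hmin
  rw [nsmul_eq_mul] at hup hlow
  have hc : (2 : ℝ) < D.card := by linarith
  have hc3 : (3 : ℝ) ≤ D.card := by
    have : 2 < D.card := by exact_mod_cast hc
    exact_mod_cast this
  nlinarith

/-- Packings without conflicts: `f` assigns items of `C` to the `t` bins, no bin is empty, and at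
most one medium item has no other item of size greater than `1/3` in its bin. -/
theorem exists_packing {ι : Type*} (s : ι → ℝ) (hs : ∀ x, s x ∈ Set.Icc (0 : ℝ) 1)
    (C : Finset ι) :
    ∃ (t : ℕ) (f : ι → ℕ),
      (∀ x ∈ C, f x < t) ∧
      (∀ i < t, ∃ x ∈ C, f x = i) ∧
      (∀ i, ∑ x ∈ C.filter (fun x => f x = i), s x ≤ 1) ∧
      (∀ x ∈ C, ∀ y ∈ C, 1/3 < s x → s x ≤ 1/2 → 1/3 < s y → s y ≤ 1/2 →
        (∀ z ∈ C, f z = f x → 1/3 < s z → z = x) →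
        (∀ z ∈ C, f z = f y → 1/3 < s z → z = y) → x = y) ∧
      (t : ℝ) ≤ 1 + ∑ x ∈ C, itemWeight (s x) := by
  induction C using Finset.induction_on_min_value s with
  | empty => exact ⟨0, fun _ => 0, by simp⟩
  | insert a C haC hmin ih =>
    obtain ⟨t, f, hlt, hne, hcap, hlone, ht⟩ := ih
    have hfilter : ∀ j i, (insert a C).filter (fun x => Function.update f a j x = i) =
        if j = i then insert a (C.filter fun x => f x = i) else C.filter fun x => f x = i := by
      intro j i
      ext x
      by_cases hx : x = a
      · subst hx
        split_ifs with h <;> simp [h, haC]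
      · split_ifs with h <;> simp [hx]
    have haF : ∀ i, a ∉ C.filter (fun x => f x = i) := fun i h => haC (Finset.mem_filter.1 h).1
    have hf : ∀ j, ∀ x ∈ C, Function.update f a j x = f x := fun j x hx =>
      Function.update_of_ne (ne_of_mem_of_not_mem hx haC) _ _
    have hcap' : ∀ j, ∑ x ∈ C.filter (fun x => f x = j), s x + s a ≤ 1 →
        ∀ i, ∑ x ∈ (insert a C).filter (fun x => Function.update f a j x = i), s x ≤ 1 := by
      intro j hj i
      rw [hfilter]
      split_ifs with h
      · subst h
        rw [Finset.sum_insert (haF j)]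
        linarith
      · exact hcap i
    have hwa := itemWeight_nonneg (hs a).1
    by_cases hfit : ∃ j < t, ∑ x ∈ C.filter (fun x => f x = j), s x + s a ≤ 1
    · obtain ⟨j, hjt, hj⟩ := hfit
      refine ⟨t, Function.update f a j, ?_, ?_, hcap' j hj, ?_, ?_⟩
      · intro x hx
        rcases Finset.mem_insert.1 hx with rfl | hx
        · simpa using hjt
        · rw [hf j x hx]; exact hlt x hx
      · intro i hi
        obtain ⟨x, hx, hxi⟩ := hne i hi
        exact ⟨x, Finset.mem_insert_of_mem hx, by rw [hf j x hx, hxi]⟩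
      · have key : 1/3 < s a →
            ¬ ∀ z ∈ insert a C, Function.update f a j z = Function.update f a j a →
              1/3 < s z → z = a := by
          intro h3 h
          obtain ⟨x, hx, hxj⟩ := hne j hjt
          have := h x (Finset.mem_insert_of_mem hx) (by rw [hf j x hx]; simpa using hxj)
            (h3.trans_le (hmin x hx))
          exact haC (this ▸ hx)
        intro x hx y hy hx3 hx2 hy3 hy2 hlx hly
        rcases Finset.mem_insert.1 hx with rfl | hx
        · exact absurd hlx (key hx3)
        rcases Finset.mem_insert.1 hy with rfl | hy
        · exact absurd hly (key hy3)
        refine hlone x hx y hy hx3 hx2 hy3 hy2 (fun z hz hzx => ?_) (fun z hz hzy => ?_)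
        · exact hlx z (Finset.mem_insert_of_mem hz) (by rw [hf j z hz, hf j x hx, hzx])
        · exact hly z (Finset.mem_insert_of_mem hz) (by rw [hf j z hz, hf j y hy, hzy])
      · rw [Finset.sum_insert haC]; linarith
    push Not at hfit
    have hnone : ∀ x ∈ C, f x ≠ t := fun x hx => (hlt x hx).ne
    refine ⟨t + 1, Function.update f a t, ?_, ?_, hcap' t ?_, ?_, ?_⟩
    · intro x hx
      rcases Finset.mem_insert.1 hx with rfl | hx
      · simp
      · rw [hf t x hx]; exact (hlt x hx).trans (Nat.lt_succ_self t)
    · intro i hi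
      rcases Nat.lt_succ_iff_lt_or_eq.1 hi with hi | rfl
      · obtain ⟨x, hx, hxi⟩ := hne i hi
        exact ⟨x, Finset.mem_insert_of_mem hx, by rw [hf t x hx, hxi]⟩
      · exact ⟨a, Finset.mem_insert_self a C, by simp⟩
    · rw [Finset.filter_false_of_mem hnone]
      simpa using (hs a).2
    · have key : 1/3 < s a → ∀ y ∈ C, s y ≤ 1/2 →
          ¬ ∀ z ∈ insert a C, Function.update f a t z = Function.update f a t y →
            1/3 < s z → z = y := by
        intro h3 y hy hy2 h
        have hsingle : C.filter (fun x => f x = f y) = {y} := by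
          ext z
          simp only [Finset.mem_filter, Finset.mem_singleton]
          refine ⟨fun hz => ?_, fun hz => by rw [hz]; exact ⟨hy, rfl⟩⟩
          exact h z (Finset.mem_insert_of_mem hz.1) (by rw [hf t z hz.1, hf t y hy, hz.2])
            (h3.trans_le (hmin z hz.1))
        have := hfit (f y) (hlt y hy)
        rw [hsingle, Finset.sum_singleton] at this
        linarith [hmin y hy]
      intro x hx y hy hx3 hx2 hy3 hy2 hlx hly
      rcases Finset.mem_insert.1 hx with rfl | hxC
      · rcases Finset.mem_insert.1 hy with rfl | hyC
        · rfl
        · exact absurd hly (key hx3 y hyC hy2)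
      rcases Finset.mem_insert.1 hy with rfl | hyC
      · exact absurd hlx (key hy3 x hxC hx2)
      refine hlone x hxC y hyC hx3 hx2 hy3 hy2 (fun z hz hzx => ?_) (fun z hz hzy => ?_)
      · exact hlx z (Finset.mem_insert_of_mem hz) (by rw [hf t z hz, hf t x hxC, hzx])
      · exact hly z (Finset.mem_insert_of_mem hz) (by rw [hf t z hz, hf t y hyC, hzy])
    · set W : ℕ → ℝ := fun i => ∑ x ∈ C.filter (fun x => f x = i), itemWeight (s x) with hW
      have hfib : ∑ i ∈ Finset.range t, W i = ∑ x ∈ C, itemWeight (s x) :=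
        Finset.sum_fiberwise_of_maps_to (fun x hx => Finset.mem_range.2 (hlt x hx)) _
      have hbin : ∀ i < t, 1 ≤ W i ∨ (2/3 ≤ W i ∧ 1/3 ≤ itemWeight (s a) ∧
          ∃ x ∈ C, f x = i ∧ 1/3 < s x ∧ s x ≤ 1/2 ∧
            ∀ z ∈ C, f z = f x → 1/3 < s z → z = x) := by
        intro i hi
        obtain ⟨x, hx, hxi⟩ := hne i hi
        refine (one_le_weight_or_lonely s (C.filter fun x => f x = i) (s a) (hs a).1
          ⟨x, Finset.mem_filter.2 ⟨hx, hxi⟩⟩ (fun z hz => hmin z (Finset.mem_filter.1 hz).1)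
          (hfit i hi)).imp id ?_
        rintro ⟨h1, h2, y, hy, hy3, hy2, hly⟩
        obtain ⟨hyC, rfl⟩ := Finset.mem_filter.1 hy
        exact ⟨h1, h2, y, hyC, rfl, hy3, hy2,
          fun z hz hzy => hly z (Finset.mem_filter.2 ⟨hz, hzy⟩)⟩
      suffices h : (t : ℝ) ≤ ∑ i ∈ Finset.range t, W i + itemWeight (s a) by
        rw [Finset.sum_insert haC, ← hfib]
        push_cast
        linarith
      by_cases hall : ∀ i ∈ Finset.range t, 1 ≤ W i
      · have := Finset.card_nsmul_le_sum _ W 1 hall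
        simp only [Finset.card_range, nsmul_eq_mul, mul_one] at this
        linarith
      push Not at hall
      obtain ⟨j, hj, hjW⟩ := hall
      obtain ⟨h23, h13, x, hx, rfl, hx3, hx2, hlx⟩ :=
        (hbin j (Finset.mem_range.1 hj)).resolve_left (not_le.2 hjW)
      have hrest : ∀ i ∈ (Finset.range t).erase (f x), 1 ≤ W i := by
        intro i hi
        obtain ⟨hix, hi⟩ := Finset.mem_erase.1 hi
        refine (hbin i (Finset.mem_range.1 hi)).resolve_right ?_
        rintro ⟨-, -, y, hy, rfl, hy3, hy2, hly⟩
        exact hix (congrArg f (hlone y hy x hx hy3 hy2 hx3 hx2 hly hlx))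
      have hsum := Finset.card_nsmul_le_sum _ W 1 hrest
      have hcard := Finset.card_erase_add_one hj
      rw [Finset.card_range] at hcard
      have hcard' : (((Finset.range t).erase (f x)).card : ℝ) + 1 = t := by exact_mod_cast hcard
      rw [nsmul_eq_mul, mul_one] at hsum
      rw [← Finset.add_sum_erase _ W hj]
      linarith

/-- For every bin packing with conflicts instance `(I, s, E)` with conflict graph
`G = (I, E)`, there exists a packing of `I` into at most
`χ(G) + |L| + (3/2)·s(M) + (4/3)·s(S)` bins. -/
theorem stmt_5 {ι : Type*} [Fintype ι]
    (s : ι → ℝ) (hs : ∀ x, s x ∈ Set.Icc (0 : ℝ) 1)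
    (G : SimpleGraph ι) (k : ℕ) (hk : G.chromaticNumber = (k : ℕ∞)) :
    ∃ (t : ℕ) (B : Fin t → Finset ι),
      (∀ x : ι, ∃! i, x ∈ B i) ∧
      (∀ i, ∀ u ∈ B i, ∀ v ∈ B i, ¬ G.Adj u v) ∧
      (∀ i, ∑ x ∈ B i, s x ≤ 1) ∧
      (t : ℝ) ≤ (k : ℝ) + ((univ.filter fun x => 1/2 < s x).card : ℝ)
        + 3/2 * ∑ x ∈ univ.filter (fun x => 1/3 < s x ∧ s x ≤ 1/2), s x
        + 4/3 * ∑ x ∈ univ.filter (fun x => s x ≤ 1/3), s x := by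
  obtain ⟨c⟩ : G.Colorable k := SimpleGraph.chromaticNumber_le_iff_colorable.1 hk.le
  choose t f hlt _ hcap _ ht using
    fun j : Fin k => exists_packing s hs (univ.filter fun x => c x = j)
  refine ⟨∑ j, t j, fun i => univ.filter fun x => c x = (finSigmaFinEquiv.symm i).1 ∧
    f (c x) x = (finSigmaFinEquiv.symm i).2, ?_, ?_, ?_, ?_⟩
  · intro x
    have hx : f (c x) x < t (c x) := hlt (c x) x (by simp)
    refine ⟨finSigmaFinEquiv ⟨c x, ⟨f (c x) x, hx⟩⟩, ?_, ?_⟩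
    · simp only [Finset.mem_filter, Finset.mem_univ, true_and]
      rw [Equiv.symm_apply_apply]
      exact ⟨rfl, rfl⟩
    intro i hi
    obtain ⟨⟨j, m⟩, rfl⟩ := finSigmaFinEquiv.surjective i
    simp only [Finset.mem_filter, Finset.mem_univ, true_and] at hi
    rw [Equiv.symm_apply_apply] at hi
    obtain ⟨rfl, hm⟩ := hi
    congr 2
    exact Fin.ext hm.symm
  · intro i u hu v hv hadj
    exact c.valid hadj ((Finset.mem_filter.1 hu).2.1.trans (Finset.mem_filter.1 hv).2.1.symm)
  · intro i
    convert hcap (finSigmaFinEquiv.symm i).1 (finSigmaFinEquiv.symm i).2 using 2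
    ext x
    simp only [Finset.mem_filter, Finset.mem_univ, true_and]
    exact and_congr_right fun h => by rw [h]
  · have hsum := Finset.sum_le_sum fun j (_ : j ∈ (univ : Finset (Fin k))) => ht j
    rw [Finset.sum_add_distrib, Finset.sum_fiberwise] at hsum
    simp only [Finset.sum_const, Finset.card_univ, Fintype.card_fin, nsmul_eq_mul, mul_one,
      sum_itemWeight] at hsum
    push_cast
    linarith
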